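/- Let K be an origin-symmetric convex body in ℝ^n and let N_K(x) = ‖x‖₂ / vol_{n-1}(K ∩ x^⊥) for x ≠ 0, N_K(0) = 0. Then the maximum of N_K over the cube [-1,1]^n is attained at a vertex: max_{x ∈ [-1,1]^n} N_K(x) = max_{s ∈ {-1,1}^n} N_K(s). -/

import Mathlib

open MeasureTheory Finset
open scoped Classical

/-- The (n-1)-dimensional Hausdorff measure of the central hyperplane section
`K ∩ x^⊥`. -/
noncomputable def sectVol (n : ℕ) (K : Set (EuclideanSpace ℝ (Fin n)))
    (a : EuclideanSpace ℝ (Fin n)) : ℝ :=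
  (Measure.hausdorffMeasure ((n : ℝ) - 1)
    (K ∩ {x : EuclideanSpace ℝ (Fin n) | inner ℝ x a = (0 : ℝ)})).toReal

/-- Busemann's function `N_K(x) = ‖x‖₂ / vol_{n-1}(K ∩ x^⊥)`, with `N_K(0) = 0`. -/
noncomputable def NK (n : ℕ) (K : Set (EuclideanSpace ℝ (Fin n)))
    (x : EuclideanSpace ℝ (Fin n)) : ℝ :=
  if x = 0 then 0 else ‖x‖ / sectVol n K x

open scoped ENNReal

/-- One-dimensional Brunn–Minkowski inequality. -/
theorem Real.volume_add_volume_le_of_add_mem {A B C : Set ℝ} (hA : MeasurableSet A)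
    (hB : MeasurableSet B) (hA' : A.Nonempty) (hB' : B.Nonempty)
    (h : ∀ a ∈ A, ∀ b ∈ B, a + b ∈ C) : volume A + volume B ≤ volume C := by
  have key : ∀ P Q : Set ℝ, IsCompact P → IsCompact Q → P.Nonempty → Q.Nonempty →
      P ⊆ A → Q ⊆ B → volume P + volume Q ≤ volume C := by
    intro P Q hP hQ hPn hQn hPA hQB
    obtain ⟨p, hpP, hp⟩ := hP.exists_isGreatest hPn
    obtain ⟨q, hqQ, hq⟩ := hQ.exists_isLeast hQn
    have hsub : (fun x => q + x) '' P ∪ (fun x => p + x) '' Q ⊆ C := by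
      rintro _ (⟨x, hx, rfl⟩ | ⟨x, hx, rfl⟩)
      · simpa [add_comm] using h x (hPA hx) q (hQB hqQ)
      · exact h p (hPA hpP) x (hQB hx)
    have hdisj : AEDisjoint volume ((fun x => q + x) '' P) ((fun x => p + x) '' Q) := by
      refine measure_mono_null (t := {p + q}) ?_ (by simp)
      rintro _ ⟨⟨x, hx, rfl⟩, y, hy, hxy⟩
      have h1 := hp hx
      have h2 := hq hy
      simp only [Set.mem_singleton_iff] at *
      linarith
    have hQm : NullMeasurableSet ((fun x => p + x) '' Q) volume :=
      (hQ.image (by fun_prop)).measurableSet.nullMeasurableSet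
    calc volume P + volume Q
        = volume ((fun x => q + x) '' P) + volume ((fun x => p + x) '' Q) := by simp
      _ = volume ((fun x => q + x) '' P ∪ (fun x => p + x) '' Q) :=
          (measure_union₀ hQm hdisj).symm
      _ ≤ volume C := measure_mono hsub
  obtain ⟨a, ha⟩ := hA'
  obtain ⟨b, hb⟩ := hB'
  have e : ∀ S : Set ℝ, MeasurableSet S →
      volume S = ⨆ P : Set ℝ, ⨆ _ : P ⊆ S ∧ IsCompact P, volume P := by
    intro S hS
    rw [hS.measure_eq_iSup_isCompact]
    simp only [iSup_and]
  rw [e A hA, e B hB]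
  refine ENNReal.biSup_add_biSup_le' ⟨∅, by simp⟩ ⟨∅, by simp⟩ ?_
  rintro P ⟨hPA, hP⟩ Q ⟨hQB, hQ⟩
  exact (add_le_add (measure_mono (Set.subset_insert a P))
    (measure_mono (Set.subset_insert b Q))).trans
    (key _ _ (hP.insert a) (hQ.insert b) (Set.insert_nonempty _ _) (Set.insert_nonempty _ _)
      (Set.insert_subset ha hPA) (Set.insert_subset hb hQB))

theorem MeasureTheory.lintegral_div_eq_lintegral_meas_lt {α : Type*} [MeasurableSpace α]
    {μ : Measure α} {F : α → ℝ≥0∞} (hF : Measurable F) {a : ℝ} (ha : 0 < a)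
    (hFa : ∀ x, F x ≤ ENNReal.ofReal a) :
    (∫⁻ x, F x ∂μ) / ENNReal.ofReal a
      = ∫⁻ t in Set.Ioo (0 : ℝ) 1, μ {x | ENNReal.ofReal (t * a) < F x} := by
  have hfin : ∀ x, F x ≠ ∞ := fun x => ne_top_of_le_ne_top ENNReal.ofReal_ne_top (hFa x)
  have h1 : (∫⁻ x, F x ∂μ) / ENNReal.ofReal a
      = ∫⁻ x, ENNReal.ofReal ((F x).toReal / a) ∂μ := by
    rw [ENNReal.div_eq_inv_mul, ← lintegral_const_mul _ hF]
    refine lintegral_congr fun x => ?_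
    rw [ENNReal.ofReal_div_of_pos ha, ENNReal.ofReal_toReal (hfin x), ENNReal.div_eq_inv_mul]
  have hset : ∀ t > (0 : ℝ), {x | t < (F x).toReal / a} = {x | ENNReal.ofReal (t * a) < F x} := by
    intro t ht
    ext x
    simp only [Set.mem_ofPred_eq]
    rw [lt_div_iff₀ ha, ENNReal.ofReal_lt_iff_lt_toReal (by positivity) (hfin x)]
  rw [h1, lintegral_eq_lintegral_meas_lt μ (Filter.Eventually.of_forall fun x => by
    simp only [Pi.zero_apply]; positivity) (by fun_prop)]
  rw [setLIntegral_congr_fun measurableSet_Ioi (g := fun t => μ {x | ENNReal.ofReal (t * a) < F x})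
    (fun t ht => by simp only; rw [hset t ht])]
  rw [← Set.Ioo_union_Ici_eq_Ioi (zero_lt_one' ℝ), lintegral_union measurableSet_Ici]
  · have : ∫⁻ t in Set.Ici (1 : ℝ), μ {x | ENNReal.ofReal (t * a) < F x} = 0 := by
      rw [setLIntegral_congr_fun measurableSet_Ici (g := fun _ => 0)]
      · simp
      · intro t ht
        have : {x | ENNReal.ofReal (t * a) < F x} = ∅ := by
          ext x
          simp only [Set.mem_ofPred_eq, Set.mem_empty_iff_false, iff_false, not_lt]
          refine (hFa x).trans (ENNReal.ofReal_le_ofReal ?_)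
          have : (1 : ℝ) ≤ t := ht
          nlinarith
        simp [this]
    rw [this, add_zero]
  · exact Set.disjoint_left.2 fun x hx hx' => not_le.2 hx.2 hx'

theorem MeasureTheory.lintegral_meas_lt_le_lintegral_div {α : Type*} [MeasurableSpace α]
    {μ : Measure α} {H : α → ℝ≥0∞} (hH : Measurable H) {c : ℝ} (hc : 0 < c) :
    ∫⁻ t in Set.Ioo (0 : ℝ) 1, μ {x | ENNReal.ofReal (t * c) < H x}
      ≤ (∫⁻ x, H x ∂μ) / ENNReal.ofReal c := by
  have hm : Measurable fun x => min (H x) (ENNReal.ofReal c) := hH.min measurable_const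
  have e := lintegral_div_eq_lintegral_meas_lt (μ := μ) hm hc (fun x => min_le_right _ _)
  calc _ = ∫⁻ t in Set.Ioo (0 : ℝ) 1,
        μ {x | ENNReal.ofReal (t * c) < min (H x) (ENNReal.ofReal c)} := by
        refine setLIntegral_congr_fun measurableSet_Ioo fun t ht => ?_
        have : ENNReal.ofReal (t * c) < ENNReal.ofReal c :=
          (ENNReal.ofReal_lt_ofReal_iff hc).2 (by nlinarith [ht.2])
        simp [this]
    _ = _ := e.symm
    _ ≤ _ := by gcongr; exact min_le_left _ _

theorem lintegral_div_add_lintegral_div_le {F G H : ℝ → ℝ≥0∞} (hF : Measurable F)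
    (hG : Measurable G) (hH : Measurable H) {a b c : ℝ} (ha : 0 < a) (hb : 0 < b) (hc : 0 < c)
    (hFa : ⨆ x, F x = ENNReal.ofReal a) (hGb : ⨆ x, G x = ENNReal.ofReal b)
    (h : ∀ x y t, t ∈ Set.Ioo (0 : ℝ) 1 → ENNReal.ofReal (t * a) < F x →
      ENNReal.ofReal (t * b) < G y → ENNReal.ofReal (t * c) < H (x + y)) :
    (∫⁻ x, F x) / ENNReal.ofReal a + (∫⁻ x, G x) / ENNReal.ofReal b
      ≤ (∫⁻ x, H x) / ENNReal.ofReal c := by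
  have hne : ∀ (F : ℝ → ℝ≥0∞) (a t : ℝ), 0 < a → t ∈ Set.Ioo (0 : ℝ) 1 →
      ⨆ x, F x = ENNReal.ofReal a → {x | ENNReal.ofReal (t * a) < F x}.Nonempty := by
    intro F a t ha ht hFa
    have hlt : ENNReal.ofReal (t * a) < ⨆ x, F x := by
      rw [hFa, ENNReal.ofReal_lt_ofReal_iff ha]
      nlinarith [ht.2]
    exact lt_iSup_iff.1 hlt
  rw [lintegral_div_eq_lintegral_meas_lt hF ha fun x => hFa ▸ le_iSup F x,
    lintegral_div_eq_lintegral_meas_lt hG hb fun x => hGb ▸ le_iSup G x, ← lintegral_add_left]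
  · refine le_trans ?_ (lintegral_meas_lt_le_lintegral_div hH hc)
    refine setLIntegral_mono' measurableSet_Ioo fun t ht => ?_
    exact Real.volume_add_volume_le_of_add_mem (measurableSet_lt measurable_const hF)
      (measurableSet_lt measurable_const hG) (hne F a t ha ht hFa) (hne G b t hb ht hGb)
      fun x hx y hy => h x y t ht hx hy
  · refine Antitone.measurable fun s t hst => measure_mono fun x hx => ?_
    exact lt_of_le_of_lt (ENNReal.ofReal_le_ofReal (by gcongr)) hx

/-- `H (x + y) ^ (-1/k) ≤ F x ^ (-1/k) + G y ^ (-1/k)` for all `x, y`, phrased through strict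
lower bounds on the values. -/
def InvPowSubadditive {V : Type*} [Add V] (k : ℕ) (F G H : V → ℝ≥0∞) : Prop :=
  ∀ x y, ∀ s t : ℝ, 0 < s → 0 < t → ENNReal.ofReal (s ^ k)⁻¹ < F x →
    ENNReal.ofReal (t ^ k)⁻¹ < G y → ENNReal.ofReal ((s + t) ^ k)⁻¹ < H (x + y)

theorem exists_bounded_le_lt_lintegral {α : Type*} [MeasurableSpace α] {μ : Measure α}
    {F : α → ℝ≥0∞} (hF : Measurable F) {r : ℝ≥0∞} (hr : r < ∫⁻ x, F x ∂μ) :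
    ∃ F' : α → ℝ≥0∞, Measurable F' ∧ (∀ x, F' x ≤ F x) ∧ r < ∫⁻ x, F' x ∂μ ∧
      ∃ a : ℝ, 0 < a ∧ ⨆ x, F' x = ENNReal.ofReal a := by
  have hsup : ∀ x, F x = ⨆ j : ℕ, min (F x) j := by
    intro x
    rw [← inf_iSup_eq, ENNReal.iSup_natCast, inf_top_eq]
  have hmono : Monotone fun (j : ℕ) x => min (F x) (j : ℝ≥0∞) := by
    intro i j hij x
    exact min_le_min le_rfl (by exact_mod_cast hij)
  have hmeas : ∀ j : ℕ, Measurable fun x => min (F x) (j : ℝ≥0∞) := fun j =>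
    hF.min measurable_const
  rw [lintegral_congr hsup, lintegral_iSup hmeas hmono] at hr
  obtain ⟨j, hj⟩ := lt_iSup_iff.1 hr
  have hle : ⨆ x, min (F x) (j : ℝ≥0∞) ≤ j := iSup_le fun x => min_le_right _ _
  have htop : ⨆ x, min (F x) (j : ℝ≥0∞) ≠ ∞ := ne_top_of_le_ne_top (ENNReal.natCast_ne_top j) hle
  refine ⟨_, hmeas j, fun x => min_le_left _ _, hj, (⨆ x, min (F x) (j : ℝ≥0∞)).toReal,
    ENNReal.toReal_pos ?_ htop, (ENNReal.ofReal_toReal htop).symm⟩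
  intro h0
  rw [ENNReal.iSup_eq_zero] at h0
  simp [h0] at hj

theorem exists_pos_inv_pow_eq (k : ℕ) {a : ℝ} (ha : 0 < a) :
    ∃ α : ℝ, 0 < α ∧ (α ^ (k + 1))⁻¹ = a :=
  ⟨a⁻¹ ^ ((k + 1 : ℕ) : ℝ)⁻¹, by positivity, by
    rw [Real.rpow_inv_natCast_pow (by positivity) (by simp), inv_inv]⟩

theorem inv_add_pow_le_div {s t α β : ℝ} (k : ℕ) (hs : 0 < s) (ht : 0 < t) (hα : 0 < α)
    (hβ : 0 < β) :
    ((s + t) ^ k)⁻¹ ≤ ((s ^ k)⁻¹ * α ^ (k + 1) + (t ^ k)⁻¹ * β ^ (k + 1)) / (α + β) ^ (k + 1) := by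
  have hαs : α / s ∈ Set.Ici (0 : ℝ) := (div_pos hα hs).le
  have hβt : β / t ∈ Set.Ici (0 : ℝ) := (div_pos hβ ht).le
  have hc := (convexOn_pow (𝕜 := ℝ) (k + 1)).2 hαs hβt (div_pos hs (add_pos hs ht)).le
    (div_pos ht (add_pos hs ht)).le (by field_simp)
  simp only [smul_eq_mul] at hc
  have e : s / (s + t) * (α / s) + t / (s + t) * (β / t) = (α + β) / (s + t) := by field_simp
  have e2 : s / (s + t) * (α / s) ^ (k + 1) + t / (s + t) * (β / t) ^ (k + 1)
      = ((s ^ k)⁻¹ * α ^ (k + 1) + (t ^ k)⁻¹ * β ^ (k + 1)) / (s + t) := by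
    rw [div_pow, div_pow, pow_succ s, pow_succ t]
    field_simp
  rw [e, e2, div_pow, div_le_div_iff₀ (by positivity) (by positivity)] at hc
  rw [inv_eq_one_div, div_le_div_iff₀ (by positivity) (by positivity), one_mul]
  have : 0 < s + t := by positivity
  refine le_of_mul_le_mul_right ?_ this
  calc _ ≤ _ := hc
    _ = _ := by ring

/-- One-dimensional Borell–Brascamp–Lieb inequality with exponent `-1/(k+1)`. -/
theorem InvPowSubadditive.lt_lintegral {k : ℕ} {F G H : ℝ → ℝ≥0∞} (hF : Measurable F)
    (hG : Measurable G) (hH : Measurable H) (h : InvPowSubadditive (k + 1) F G H) {s t : ℝ}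
    (hs : 0 < s) (ht : 0 < t) (hsF : ENNReal.ofReal (s ^ k)⁻¹ < ∫⁻ x, F x)
    (htG : ENNReal.ofReal (t ^ k)⁻¹ < ∫⁻ x, G x) :
    ENNReal.ofReal ((s + t) ^ k)⁻¹ < ∫⁻ x, H x := by
  obtain ⟨F', hF', hFF', hsF', a, ha, hFa⟩ := exists_bounded_le_lt_lintegral hF hsF
  obtain ⟨G', hG', hGG', htG', b, hb, hGb⟩ := exists_bounded_le_lt_lintegral hG htG
  obtain ⟨α, hα, rfl⟩ := exists_pos_inv_pow_eq k ha
  obtain ⟨β, hβ, rfl⟩ := exists_pos_inv_pow_eq k hb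
  have hc : 0 < ((α + β) ^ (k + 1))⁻¹ := by positivity
  have key := lintegral_div_add_lintegral_div_le hF' hG' hH ha hb hc hFa hGb (by
    intro x y r hr hx hy
    obtain ⟨ρ, hρ, rfl⟩ := exists_pos_inv_pow_eq k hr.1
    rw [← mul_inv, ← mul_pow] at hx hy ⊢
    rw [mul_add]
    exact h x y _ _ (by positivity) (by positivity) (hx.trans_le (hFF' x)) (hy.trans_le (hGG' y)))
  have hstrict : ∀ (A : ℝ≥0∞) (u v : ℝ), 0 < u → 0 < v → ENNReal.ofReal v < A →
      ENNReal.ofReal (v * u) < A / ENNReal.ofReal u⁻¹ := by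
    intro A u v hu hv hA
    rw [ENNReal.lt_div_iff_mul_lt (by simp [hu]) (by simp), ← ENNReal.ofReal_mul (by positivity),
      mul_assoc, mul_inv_cancel₀ hu.ne', mul_one]
    exact hA
  have h1 := hstrict _ (α ^ (k + 1)) _ (by positivity) (by positivity) hsF'
  have h2 := hstrict _ (β ^ (k + 1)) _ (by positivity) (by positivity) htG'
  have h3 := (ENNReal.add_lt_add h1 h2).trans_le key
  rw [← ENNReal.ofReal_add (by positivity) (by positivity),
    ENNReal.lt_div_iff_mul_lt (by simp) (by simp), ← ENNReal.ofReal_mul (by positivity),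
    ← div_eq_mul_inv] at h3
  exact (ENNReal.ofReal_le_ofReal (inv_add_pow_le_div k hs ht hα hβ)).trans_lt h3

theorem lintegral_fin_succ {m : ℕ} {F : (Fin (m + 1) → ℝ) → ℝ≥0∞} (hF : Measurable F) :
    ∫⁻ x, F x = ∫⁻ t : ℝ, ∫⁻ w : Fin m → ℝ, F (Fin.cons t w) := by
  have e := volume_preserving_piFinSuccAbove (fun _ : Fin (m + 1) => ℝ) 0
  rw [← (e.symm).lintegral_comp hF, Measure.volume_eq_prod, lintegral_prod _ (by fun_prop)]
  simp [MeasurableEquiv.piFinSuccAbove_symm_apply, Fin.insertNthEquiv]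

/-- Borell–Brascamp–Lieb inequality in dimension `m` with exponent `-1/(k+m)`. -/
theorem InvPowSubadditive.lt_lintegral_pi (m : ℕ) :
    ∀ {k : ℕ} {F G H : (Fin m → ℝ) → ℝ≥0∞}, Measurable F → Measurable G → Measurable H →
      InvPowSubadditive (k + m) F G H → ∀ {s t : ℝ}, 0 < s → 0 < t →
      ENNReal.ofReal (s ^ k)⁻¹ < ∫⁻ x, F x → ENNReal.ofReal (t ^ k)⁻¹ < ∫⁻ x, G x →
      ENNReal.ofReal ((s + t) ^ k)⁻¹ < ∫⁻ x, H x := by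
  induction m with
  | zero =>
    intro k F G H hF hG hH h s t hs ht hsF htG
    simp only [Measure.volume_pi_eq_dirac (0 : Fin 0 → ℝ), lintegral_dirac] at hsF htG ⊢
    have := h _ _ s t hs ht hsF htG
    rwa [add_zero (0 : Fin 0 → ℝ)] at this
  | succ m ih =>
    intro k F G H hF hG hH h s t hs ht hsF htG
    have hcons : Measurable fun p : ℝ × (Fin m → ℝ) => (Fin.cons p.1 p.2 : Fin (m + 1) → ℝ) := by
      simpa [MeasurableEquiv.piFinSuccAbove_symm_apply, Fin.insertNthEquiv] using
        (MeasurableEquiv.piFinSuccAbove (fun _ : Fin (m + 1) => ℝ) 0).symm.measurable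
    have hm : ∀ {F : (Fin (m + 1) → ℝ) → ℝ≥0∞}, Measurable F →
        Measurable fun t : ℝ => ∫⁻ w : Fin m → ℝ, F (Fin.cons t w) :=
      fun hF => (hF.comp hcons).lintegral_prod_right'
    rw [lintegral_fin_succ hF] at hsF
    rw [lintegral_fin_succ hG] at htG
    rw [lintegral_fin_succ hH]
    refine InvPowSubadditive.lt_lintegral (hm hF) (hm hG) (hm hH) ?_ hs ht hsF htG
    intro x y s t hs ht hsF htG
    have hsec : ∀ {F : (Fin (m + 1) → ℝ) → ℝ≥0∞}, Measurable F → ∀ x : ℝ,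
        Measurable fun w : Fin m → ℝ => F (Fin.cons x w) :=
      fun hF x => hF.comp (hcons.comp measurable_prodMk_left)
    refine ih (hsec hF x) (hsec hG y) (hsec hH (x + y)) ?_ hs ht hsF htG
    intro v w s t hs ht hv hw
    rw [add_right_comm, add_assoc] at hv hw ⊢
    have := h (Fin.cons x v) (Fin.cons y w) s t hs ht hv hw
    rwa [show (Fin.cons x v + Fin.cons y w : Fin (m + 1) → ℝ) = Fin.cons (x + y) (v + w) by
      funext i; refine Fin.cases ?_ (fun i => ?_) i <;> simp] at this

theorem InvPowSubadditive.inv_lintegral_le {m : ℕ} {F G H : (Fin m → ℝ) → ℝ≥0∞}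
    (hF : Measurable F) (hG : Measurable G) (hH : Measurable H)
    (h : InvPowSubadditive (m + 1) F G H) :
    (∫⁻ x, H x)⁻¹ ≤ (∫⁻ x, F x)⁻¹ + (∫⁻ x, G x)⁻¹ := by
  rw [add_comm m 1] at h
  have step : ∀ (A : ℝ≥0∞) (ε : ℝ), A ≠ 0 → 0 < ε →
      ENNReal.ofReal ((A⁻¹.toReal + ε) ^ 1)⁻¹ < A := by
    intro A ε hA hε
    rw [pow_one, ENNReal.ofReal_inv_of_pos (by positivity), ENNReal.inv_lt_iff_inv_lt,
      ENNReal.ofReal_add (by positivity) hε.le, ENNReal.ofReal_toReal (by simpa using hA)]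
    exact ENNReal.lt_add_right (by simpa using hA) (by simpa using hε)
  rcases eq_or_ne (∫⁻ x, F x) 0 with hA | hA
  · simp [hA]
  rcases eq_or_ne (∫⁻ x, G x) 0 with hB | hB
  · simp [hB]
  refine ENNReal.le_of_forall_pos_le_add fun ε hε _ => ?_
  have hε' : (0 : ℝ) < ε / 2 := by positivity
  have key := h.lt_lintegral_pi m hF hG hH (by positivity) (by positivity)
    (step _ (ε / 2) hA hε') (step _ (ε / 2) hB hε')
  rw [pow_one, ENNReal.ofReal_inv_of_pos (by positivity), ENNReal.inv_lt_iff_inv_lt] at key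
  refine key.le.trans ?_
  rw [add_add_add_comm, add_halves, ENNReal.ofReal_add (by positivity) (by positivity),
    ENNReal.ofReal_add (by positivity) (by positivity), ENNReal.ofReal_toReal (by simpa using hA),
    ENNReal.ofReal_toReal (by simpa using hB), ENNReal.ofReal_coe_nnreal]

theorem Real.lintegral_comp_mul_left {f : ℝ → ℝ≥0∞} (hf : Measurable f) {r : ℝ} (hr : r ≠ 0) :
    ∫⁻ t, f (r * t) = ENNReal.ofReal |r⁻¹| * ∫⁻ t, f t := by
  rw [← lintegral_map hf (measurable_const_mul r), Real.map_volume_mul_left hr,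
    lintegral_smul_measure, smul_eq_mul]

theorem lintegral_abs_pow_mul_le_one (k : ℕ) {γ : ℝ} (hγ : 0 < γ) :
    ∫⁻ t : ℝ, {t : ℝ | |t| * γ ≤ 1}.indicator (fun t => ENNReal.ofReal (|t| ^ k)) t
      = (∫⁻ t in Set.Icc (-1 : ℝ) 1, ENNReal.ofReal (|t| ^ k)) *
        ENNReal.ofReal (γ ^ (k + 1))⁻¹ := by
  have hm : Measurable ((Set.Icc (-1 : ℝ) 1).indicator fun t => ENNReal.ofReal (|t| ^ k)) :=
    Measurable.indicator (by fun_prop) measurableSet_Icc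
  have e : ∀ t : ℝ, {t : ℝ | |t| * γ ≤ 1}.indicator (fun t => ENNReal.ofReal (|t| ^ k)) t
      = ENNReal.ofReal (γ ^ k)⁻¹ *
        (Set.Icc (-1 : ℝ) 1).indicator (fun t => ENNReal.ofReal (|t| ^ k)) (γ * t) := by
    intro t
    have hiff : |t| * γ ≤ 1 ↔ γ * t ∈ Set.Icc (-1 : ℝ) 1 := by
      rw [Set.mem_Icc, ← abs_le, abs_mul, abs_of_pos hγ, mul_comm]
    by_cases ht : |t| * γ ≤ 1
    · rw [Set.indicator_of_mem (by exact ht), Set.indicator_of_mem (hiff.1 ht),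
        ← ENNReal.ofReal_mul (by positivity), abs_mul, abs_of_pos hγ, mul_pow,
        inv_mul_cancel_left₀ (by positivity)]
    · rw [Set.indicator_of_notMem (by exact ht), Set.indicator_of_notMem (mt hiff.2 ht), mul_zero]
  have hmγ : Measurable fun t =>
      (Set.Icc (-1 : ℝ) 1).indicator (fun t => ENNReal.ofReal (|t| ^ k)) (γ * t) :=
    hm.comp (measurable_const_mul γ)
  rw [lintegral_congr e, lintegral_const_mul _ hmγ,
    Real.lintegral_comp_mul_left hm hγ.ne', lintegral_indicator measurableSet_Icc, ← mul_assoc,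
    ← ENNReal.ofReal_mul (by positivity), abs_of_pos (by positivity), ← mul_inv, ← pow_succ,
    mul_comm]

section Gauge

variable {E : Type*} [NormedAddCommGroup E] [NormedSpace ℝ E] {K : Set E}

theorem smul_mem_iff_abs_mul_gauge_le_one (hcl : IsClosed K) (hconv : Convex ℝ K)
    (h0 : K ∈ nhds 0) (hsym : ∀ x ∈ K, -x ∈ K) (t : ℝ) (x : E) :
    t • x ∈ K ↔ |t| * gauge K x ≤ 1 := by
  have e : gauge K (t • x) = |t| * gauge K x := by
    rw [← smul_eq_mul, ← gauge_smul_of_nonneg (abs_nonneg t)]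
    rcases abs_choice t with h | h <;> rw [h]
    rw [neg_smul, gauge_neg hsym]
  rw [← e, gauge_le_one_iff_mem_closure hconv h0, hcl.closure_eq]

variable {k : ℕ} (W : (Fin k → ℝ) →ₗ[ℝ] E)

/-- The volume of a cylinder section through the direction `u`, in terms of the gauge of `K` on
the affine subspace `u + range W`. -/
theorem lintegral_volume_section_eq [MeasurableSpace E] [BorelSpace E] (hcl : IsClosed K)
    (hconv : Convex ℝ K) (h0 : K ∈ nhds 0) (hsym : ∀ x ∈ K, -x ∈ K)
    (hbd : Bornology.IsVonNBounded ℝ K) {u : E} (hu : ∀ w, u + W w ≠ 0) :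
    ∫⁻ t : ℝ, volume {w | t • u + W w ∈ K}
      = (∫⁻ t in Set.Icc (-1 : ℝ) 1, ENNReal.ofReal (|t| ^ k)) *
        ∫⁻ w, ENNReal.ofReal (gauge K (u + W w) ^ (k + 1))⁻¹ := by
  have hW : Continuous W := W.continuous_of_finiteDimensional
  have hg : Continuous fun w => gauge K (u + W w) :=
    (continuous_gauge hconv h0).comp (continuous_const.add hW)
  set φ : ℝ → (Fin k → ℝ) → ℝ≥0∞ := fun t w =>
    {t : ℝ | |t| * gauge K (u + W w) ≤ 1}.indicator (fun t => ENNReal.ofReal (|t| ^ k)) t with hφ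
  have hφm : Measurable (Function.uncurry φ) := by
    have : Function.uncurry φ = {p : ℝ × (Fin k → ℝ) | |p.1| * gauge K (u + W p.2) ≤ 1}.indicator
        (fun p => ENNReal.ofReal (|p.1| ^ k)) := by
      ext p
      simp [hφ, Function.uncurry, Set.indicator_apply]
    rw [this]
    refine Measurable.indicator (by fun_prop) (IsClosed.measurableSet ?_)
    exact isClosed_le (by fun_prop) continuous_const
  have h1 : ∀ t : ℝ, t ≠ 0 → volume {w | t • u + W w ∈ K} = ∫⁻ w, φ t w := by
    intro t ht
    have hS : {w | |t| * gauge K (u + W w) ≤ 1} = (t • ·) ⁻¹' {w | t • u + W w ∈ K} := by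
      ext w
      simp only [Set.mem_ofPred_eq, Set.mem_preimage, map_smul]
      rw [← smul_mem_iff_abs_mul_gauge_le_one hcl hconv h0 hsym, smul_add]
    have hSm : MeasurableSet {w | |t| * gauge K (u + W w) ≤ 1} :=
      (isClosed_le (by fun_prop) continuous_const).measurableSet
    have e : ∀ w, φ t w
        = {w | |t| * gauge K (u + W w) ≤ 1}.indicator (fun _ => ENNReal.ofReal (|t| ^ k)) w := by
      intro w
      simp [hφ, Set.indicator_apply]
    rw [lintegral_congr e, lintegral_indicator_const hSm, hS, Measure.addHaar_preimage_smul _ ht,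
      Module.finrank_fin_fun, ← mul_assoc, ← ENNReal.ofReal_mul (by positivity), abs_inv, abs_pow,
      mul_inv_cancel₀ (by positivity), ENNReal.ofReal_one, one_mul]
  have h2 : ∫⁻ t : ℝ, volume {w | t • u + W w ∈ K} = ∫⁻ t, ∫⁻ w, φ t w := by
    refine lintegral_congr_ae ?_
    filter_upwards [compl_mem_ae_iff.2 (measure_singleton (0 : ℝ))] with t ht using h1 t ht
  rw [h2, lintegral_lintegral_swap hφm.aemeasurable, ← lintegral_const_mul _ (by fun_prop)]
  refine lintegral_congr fun w => ?_
  exact lintegral_abs_pow_mul_le_one k ((gauge_pos (absorbent_nhds_zero h0) hbd).2 (hu w))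

theorem invPowSubadditive_gauge (hconv : Convex ℝ K) (h0 : K ∈ nhds 0)
    (hbd : Bornology.IsVonNBounded ℝ K) {u v : E} (hu : ∀ w, u + W w ≠ 0)
    (hv : ∀ w, v + W w ≠ 0) (huv : ∀ w, u + v + W w ≠ 0) (m : ℕ) :
    InvPowSubadditive (m + 1) (fun w => ENNReal.ofReal (gauge K (u + W w) ^ (m + 1))⁻¹)
      (fun w => ENNReal.ofReal (gauge K (v + W w) ^ (m + 1))⁻¹)
      (fun w => ENNReal.ofReal (gauge K (u + v + W w) ^ (m + 1))⁻¹) := by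
  have hpos : ∀ {x : E}, x ≠ 0 → 0 < gauge K x := (gauge_pos (absorbent_nhds_zero h0) hbd).2
  have key : ∀ {g s : ℝ}, 0 < g → 0 < s →
      (ENNReal.ofReal (s ^ (m + 1))⁻¹ < ENNReal.ofReal (g ^ (m + 1))⁻¹ ↔ g < s) := by
    intro g s hg hs
    rw [ENNReal.ofReal_lt_ofReal_iff (by positivity), inv_lt_inv₀ (by positivity) (by positivity),
      pow_lt_pow_iff_left₀ hg.le hs.le (by simp)]
  intro x y s t hs ht hx hy
  simp only at hx hy ⊢
  rw [key (hpos (hu x)) hs] at hx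
  rw [key (hpos (hv y)) ht] at hy
  rw [key (hpos (huv _)) (by positivity), map_add, add_add_add_comm]
  exact (gauge_add_le hconv (absorbent_nhds_zero h0) _ _).trans_lt (add_lt_add hx hy)

theorem inv_lintegral_gauge_add_le (hconv : Convex ℝ K) (h0 : K ∈ nhds 0)
    (hbd : Bornology.IsVonNBounded ℝ K) {u v : E} (hu : ∀ w, u + W w ≠ 0)
    (hv : ∀ w, v + W w ≠ 0) (huv : ∀ w, u + v + W w ≠ 0) :
    (∫⁻ w, ENNReal.ofReal (gauge K (u + v + W w) ^ (k + 1))⁻¹)⁻¹ ≤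
      (∫⁻ w, ENNReal.ofReal (gauge K (u + W w) ^ (k + 1))⁻¹)⁻¹ +
      (∫⁻ w, ENNReal.ofReal (gauge K (v + W w) ^ (k + 1))⁻¹)⁻¹ := by
  have hm : ∀ u, Measurable fun w => ENNReal.ofReal (gauge K (u + W w) ^ (k + 1))⁻¹ := by
    intro u
    have : Measurable fun w => gauge K (u + W w) := Continuous.measurable <|
      (continuous_gauge hconv h0).comp
        (continuous_const.add W.continuous_of_finiteDimensional)
    fun_prop
  exact (invPowSubadditive_gauge W hconv h0 hbd hu hv huv k).inv_lintegral_le (hm _) (hm _) (hm _)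

theorem lintegral_gauge_ne_zero (hconv : Convex ℝ K) (h0 : K ∈ nhds 0)
    (hbd : Bornology.IsVonNBounded ℝ K) {u : E} (hu : ∀ w, u + W w ≠ 0) :
    ∫⁻ w, ENNReal.ofReal (gauge K (u + W w) ^ (k + 1))⁻¹ ≠ 0 := by
  have hg : Measurable fun w => gauge K (u + W w) := Continuous.measurable <|
    (continuous_gauge hconv h0).comp (continuous_const.add W.continuous_of_finiteDimensional)
  rw [← pos_iff_ne_zero, lintegral_pos_iff_support (by fun_prop)]
  have : (Function.support fun w => ENNReal.ofReal (gauge K (u + W w) ^ (k + 1))⁻¹)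
      = Set.univ := by
    refine Set.eq_univ_of_forall fun w => ?_
    have := (gauge_pos (absorbent_nhds_zero h0) hbd).2 (hu w)
    simp only [Function.mem_support, ne_eq, ENNReal.ofReal_eq_zero, not_le]
    positivity
  rw [this]
  exact isOpen_univ.measure_pos _ Set.univ_nonempty

end Gauge

section Section

variable {k : ℕ}

/-- The Hausdorff measure of a central hyperplane section, computed in orthonormal coordinates. -/
theorem hausdorffMeasure_inter_orthogonal_eq {E : Type*} [NormedAddCommGroup E]
    [InnerProductSpace ℝ E] [MeasurableSpace E] [BorelSpace E]
    (hE : Module.finrank ℝ E = k + 2) {K : Set E} (hK : IsClosed K)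
    {v : Fin (k + 1) → E} (hv : Orthonormal ℝ v) {a : E} (ha : a ≠ 0)
    (hva : ∀ i, inner ℝ (v i) a = (0 : ℝ)) :
    Measure.hausdorffMeasure ((k + 1 : ℕ) : ℝ) (K ∩ {x | inner ℝ x a = (0 : ℝ)})
      = (Measure.addHaarScalarFactor
          (Measure.hausdorffMeasure ((k + 1 : ℕ) : ℝ) : Measure (EuclideanSpace ℝ (Fin (k + 1))))
          volume : ℝ≥0∞) * volume {s : Fin (k + 1) → ℝ | ∑ i, s i • v i ∈ K} := by
  have : FiniteDimensional ℝ E := Module.finite_of_finrank_pos (by omega)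
  set B := EuclideanSpace.basisFun (Fin (k + 1)) ℝ
  set f : EuclideanSpace ℝ (Fin (k + 1)) →ₗ[ℝ] E := B.toBasis.constr ℝ v
  have hfB : f ∘ B.toBasis = v := by
    ext i
    simp only [f, Function.comp, Module.Basis.constr_basis]
  have hBon : Orthonormal ℝ B.toBasis := by
    rw [OrthonormalBasis.coe_toBasis]
    exact B.orthonormal
  set T := f.isometryOfOrthonormal hBon (by rw [hfB]; exact hv)
  have hT : ∀ s, T s = ∑ i, s i • v i := by
    intro s
    change f s = _
    simp only [f, Module.Basis.constr_apply_fintype]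
    simp [B]
  have hrange : Set.range T = {x | inner ℝ x a = (0 : ℝ)} := by
    have hle : LinearMap.range T.toLinearMap ≤ (ℝ ∙ a)ᗮ := by
      rintro _ ⟨s, rfl⟩
      rw [Submodule.mem_orthogonal_singleton_iff_inner_left]
      change inner ℝ (T s) a = 0
      rw [hT, sum_inner]
      simp [inner_smul_left, hva]
    have hfr : Module.finrank ℝ (LinearMap.range T.toLinearMap) = Module.finrank ℝ (ℝ ∙ a)ᗮ := by
      have h1 := Submodule.finrank_add_finrank_orthogonal (ℝ ∙ a)
      rw [finrank_span_singleton ha, hE] at h1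
      rw [LinearMap.finrank_range_of_inj T.injective, finrank_euclideanSpace_fin]
      omega
    have heq := Submodule.eq_of_le_of_finrank_eq hle hfr
    ext x
    have : x ∈ LinearMap.range T.toLinearMap ↔ x ∈ (ℝ ∙ a)ᗮ := by rw [heq]
    rw [Submodule.mem_orthogonal_singleton_iff_inner_left] at this
    exact this
  rw [← hrange, ← T.isometry.hausdorffMeasure_preimage (Or.inl (by positivity)) K]
  have hm := Measure.isAddLeftInvariant_eq_smul
    (Measure.hausdorffMeasure ((k + 1 : ℕ) : ℝ) : Measure (EuclideanSpace ℝ (Fin (k + 1)))) volume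
  have hpre : MeasurableSet (T ⁻¹' K) := (hK.preimage T.continuous).measurableSet
  conv_lhs => rw [hm]
  rw [Measure.smul_apply,
    ← (PiLp.volume_preserving_toLp (Fin (k + 1))).measure_preimage hpre.nullMeasurableSet]
  have : WithLp.toLp 2 ⁻¹' (T ⁻¹' K) = {s : Fin (k + 1) → ℝ | ∑ i, s i • v i ∈ K} := by
    ext s
    simp [hT]
  rw [this]
  rfl

/-- Rotation by a right angle in the plane spanned by the first two basis vectors, composed with
the orthogonal projection to that plane. -/
noncomputable def planeRotation {E : Type*} [NormedAddCommGroup E] [InnerProductSpace ℝ E]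
    (b : OrthonormalBasis (Fin (k + 2)) ℝ E) (a : E) : E :=
  inner ℝ (b 0) a • b 1 - inner ℝ (b 1) a • b 0

variable {E : Type*} [NormedAddCommGroup E] [InnerProductSpace ℝ E]
  (b : OrthonormalBasis (Fin (k + 2)) ℝ E)

theorem planeRotation_add (x y : E) :
    planeRotation b (x + y) = planeRotation b x + planeRotation b y := by
  simp only [planeRotation, inner_add_right, add_smul]
  abel

theorem inner_basis (i j : Fin (k + 2)) : inner ℝ (b i) (b j) = if i = j then (1 : ℝ) else 0 :=
  orthonormal_iff_ite.1 b.orthonormal i j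

theorem norm_planeRotation {a : E} (ha : ∀ i : Fin k, inner ℝ (b i.succ.succ) a = (0 : ℝ)) :
    ‖planeRotation b a‖ = ‖a‖ := by
  have h1 : ‖a‖ ^ 2 = inner ℝ (b 0) a ^ 2 + inner ℝ (b 1) a ^ 2 := by
    rw [← b.sum_sq_norm_inner_right a, Fin.sum_univ_succ, Fin.sum_univ_succ]
    simp [ha]
  have h2 : ‖planeRotation b a‖ ^ 2 = inner ℝ (b 0) a ^ 2 + inner ℝ (b 1) a ^ 2 := by
    rw [← real_inner_self_eq_norm_sq, planeRotation]
    simp only [inner_sub_left, inner_sub_right, inner_smul_left, inner_smul_right, inner_basis]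
    simp
    ring
  rw [← sq_eq_sq₀ (norm_nonneg _) (norm_nonneg _), h1, h2]

/-- The linear parametrization of the orthogonal complement of the first two basis vectors. -/
noncomputable def tailMap : (Fin k → ℝ) →ₗ[ℝ] E :=
  Fintype.linearCombination ℝ fun i : Fin k => b i.succ.succ

theorem tailMap_apply (w : Fin k → ℝ) : tailMap b w = ∑ i, w i • b i.succ.succ :=
  Fintype.linearCombination_apply _ _ _

theorem inner_planeRotation_tail (a : E) (i : Fin k) :
    inner ℝ (planeRotation b a) (b i.succ.succ) = (0 : ℝ) := by
  have h1 : ¬ (1 : Fin (k + 2)) = i.succ.succ := by simp [Fin.ext_iff]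
  have h0 : ¬ (0 : Fin (k + 2)) = i.succ.succ := by simp [Fin.ext_iff]
  simp [planeRotation, inner_sub_left, inner_smul_left, h0, h1]

theorem planeRotation_add_tailMap_ne_zero {a : E} (ha0 : a ≠ 0)
    (ha : ∀ i : Fin k, inner ℝ (b i.succ.succ) a = (0 : ℝ)) (w : Fin k → ℝ) :
    planeRotation b a + tailMap b w ≠ 0 := by
  intro h
  have h1 : inner ℝ (planeRotation b a) (planeRotation b a + tailMap b w) = ‖a‖ ^ 2 := by
    rw [inner_add_right, tailMap_apply, inner_sum, real_inner_self_eq_norm_sq,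
      norm_planeRotation b ha]
    simp [inner_smul_right, inner_planeRotation_tail]
  rw [h, inner_zero_right] at h1
  exact ha0 (by simpa using h1.symm)

theorem orthonormal_cons_planeRotation {a : E} (ha0 : a ≠ 0)
    (ha : ∀ i : Fin k, inner ℝ (b i.succ.succ) a = (0 : ℝ)) :
    Orthonormal ℝ
      (Fin.cons (‖a‖⁻¹ • planeRotation b a) fun i => b i.succ.succ : Fin (k + 1) → E) := by
  have hn : ‖a‖ ≠ 0 := by simpa using ha0
  rw [orthonormal_iff_ite]
  intro i j
  refine Fin.cases ?_ (fun i => ?_) i <;> refine Fin.cases ?_ (fun j => ?_) j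
  · simp only [Fin.cons_zero, inner_smul_left, inner_smul_right, real_inner_self_eq_norm_sq,
      norm_planeRotation b ha]
    simp
    field_simp
  · simp [inner_smul_left, inner_planeRotation_tail, (Fin.succ_ne_zero j).symm]
  · rw [real_inner_comm]
    simp [inner_smul_left, inner_planeRotation_tail]
  · simp [inner_basis]

theorem exists_orthonormalBasis_tail_orthogonal {E : Type*} [NormedAddCommGroup E]
    [InnerProductSpace ℝ E] (hE : Module.finrank ℝ E = k + 2) (x y : E) :
    ∃ b : OrthonormalBasis (Fin (k + 2)) ℝ E, ∀ i : Fin k,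
      inner ℝ (b i.succ.succ) x = (0 : ℝ) ∧ inner ℝ (b i.succ.succ) y = (0 : ℝ) := by
  have : FiniteDimensional ℝ E := Module.finite_of_finrank_pos (by omega)
  have hcard : Module.finrank ℝ E = Fintype.card (Fin (k + 2)) := by simp [hE]
  let f : Fin (k + 2) → E := Fin.cons x fun _ => y
  refine ⟨InnerProductSpace.gramSchmidtOrthonormalBasis hcard f, fun i => ⟨?_, ?_⟩⟩
  · exact InnerProductSpace.gramSchmidtOrthonormalBasis_inv_triangular hcard f
      (i := 0) (j := i.succ.succ) (Fin.succ_pos _)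
  · exact InnerProductSpace.gramSchmidtOrthonormalBasis_inv_triangular hcard f
      (i := Fin.succ 0) (j := i.succ.succ) (Fin.succ_lt_succ_iff.2 (Fin.succ_pos _))

theorem hausdorffMeasure_inter_orthogonal_eq_lintegral_gauge [MeasurableSpace E] [BorelSpace E]
    {K : Set E} (hcl : IsClosed K)
    (hconv : Convex ℝ K) (h0 : K ∈ nhds 0) (hsym : ∀ x ∈ K, -x ∈ K)
    (hbd : Bornology.IsVonNBounded ℝ K) {a : E} (ha0 : a ≠ 0)
    (ha : ∀ i : Fin k, inner ℝ (b i.succ.succ) a = (0 : ℝ)) :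
    Measure.hausdorffMeasure ((k + 1 : ℕ) : ℝ) (K ∩ {x | inner ℝ x a = (0 : ℝ)})
      = ENNReal.ofReal ‖a‖ * ((Measure.addHaarScalarFactor
          (Measure.hausdorffMeasure ((k + 1 : ℕ) : ℝ) : Measure (EuclideanSpace ℝ (Fin (k + 1))))
          volume : ℝ≥0∞) * (∫⁻ t in Set.Icc (-1 : ℝ) 1, ENNReal.ofReal (|t| ^ k)) *
        ∫⁻ w, ENNReal.ofReal (gauge K (planeRotation b a + tailMap b w) ^ (k + 1))⁻¹) := by
  have hn : 0 < ‖a‖ := by simpa using ha0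
  have hE : Module.finrank ℝ E = k + 2 := by simp [Module.finrank_eq_card_basis b.toBasis]
  set v : Fin (k + 1) → E := Fin.cons (‖a‖⁻¹ • planeRotation b a) fun i => b i.succ.succ with hv
  have hva : ∀ i, inner ℝ (v i) a = (0 : ℝ) := by
    refine Fin.cases ?_ fun i => ?_
    · simp [hv, planeRotation, inner_smul_left, inner_sub_left, mul_comm]
    · simp [hv, ha]
  rw [hausdorffMeasure_inter_orthogonal_eq hE hcl (orthonormal_cons_planeRotation b ha0 ha) ha0 hva]
  have hW : Continuous (tailMap b) := (tailMap b).continuous_of_finiteDimensional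
  have hSm : MeasurableSet {s : Fin (k + 1) → ℝ | ∑ i, s i • v i ∈ K} :=
    (hcl.preimage (f := fun s : Fin (k + 1) → ℝ => ∑ i, s i • v i) (by fun_prop)).measurableSet
  have hslice : ∀ t : ℝ, MeasurableSet {w | t • planeRotation b a + tailMap b w ∈ K} := fun t =>
    (hcl.preimage (f := fun w => t • planeRotation b a + tailMap b w) (by fun_prop)).measurableSet
  have hfun : Measurable fun t : ℝ => volume {w | t • planeRotation b a + tailMap b w ∈ K} := by
    have hS : MeasurableSet {p : ℝ × (Fin k → ℝ) | p.1 • planeRotation b a + tailMap b p.2 ∈ K} :=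
      (hcl.preimage (f := fun p : ℝ × (Fin k → ℝ) => p.1 • planeRotation b a + tailMap b p.2)
        (by fun_prop)).measurableSet
    exact measurable_measure_prodMk_left hS
  have key : volume {s : Fin (k + 1) → ℝ | ∑ i, s i • v i ∈ K}
      = ENNReal.ofReal ‖a‖ * ∫⁻ t : ℝ, volume {w | t • planeRotation b a + tailMap b w ∈ K} := by
    rw [← lintegral_indicator_one hSm, lintegral_fin_succ (measurable_one.indicator hSm)]
    have e : ∀ t : ℝ, ∫⁻ w : Fin k → ℝ,
        {s : Fin (k + 1) → ℝ | ∑ i, s i • v i ∈ K}.indicator (1 : (Fin (k + 1) → ℝ) → ℝ≥0∞)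
          (Fin.cons t w)
        = volume {w | (‖a‖⁻¹ * t) • planeRotation b a + tailMap b w ∈ K} := by
      intro t
      rw [← lintegral_indicator_one (hslice _)]
      refine lintegral_congr fun w => ?_
      simp [Set.indicator_apply, Fin.sum_univ_succ, hv, tailMap_apply, smul_smul, mul_comm]
    rw [lintegral_congr e, Real.lintegral_comp_mul_left hfun (by positivity), inv_inv, abs_norm]
  rw [key, lintegral_volume_section_eq (tailMap b) hcl hconv h0 hsym hbd
    (planeRotation_add_tailMap_ne_zero b ha0 ha)]
  ring

end Section

section Body

variable {n : ℕ} {K : Set (EuclideanSpace ℝ (Fin n))}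

theorem NK_zero (n : ℕ) (K : Set (EuclideanSpace ℝ (Fin n))) : NK n K 0 = 0 := by
  simp [NK]

theorem NK_nonneg (x : EuclideanSpace ℝ (Fin n)) : 0 ≤ NK n K x := by
  unfold NK sectVol
  split_ifs
  · exact le_rfl
  · positivity

theorem NK_smul_of_nonneg {t : ℝ} (ht : 0 ≤ t) (x : EuclideanSpace ℝ (Fin n)) :
    NK n K (t • x) = t * NK n K x := by
  rcases ht.eq_or_lt with rfl | ht
  · simp [NK_zero]
  by_cases hx : x = 0
  · simp [hx, NK_zero]
  · simp only [NK, sectVol, smul_eq_zero, ht.ne', hx, or_self, if_false, norm_smul,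
      Real.norm_of_nonneg ht.le, inner_smul_right, mul_eq_zero, false_or, mul_div_assoc]

theorem zero_mem_interior_of_convex_of_eq_neg (hconv : Convex ℝ K) (hint : (interior K).Nonempty)
    (hsym : K = -K) : (0 : EuclideanSpace ℝ (Fin n)) ∈ interior K := by
  obtain ⟨x, hx⟩ := hint
  have hnx : -x ∈ K := by
    rw [hsym]
    simpa using interior_subset hx
  simpa using hconv.combo_interior_self_mem_interior hx hnx (a := 1 / 2) (b := 1 / 2)
    (by norm_num) (by norm_num) (by norm_num)

/-- Busemann's function as the reciprocal of an integral of a power of the gauge. -/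
theorem NK_eq_toReal_inv_lintegral {k : ℕ} {K : Set (EuclideanSpace ℝ (Fin (k + 2)))}
    (hcl : IsClosed K) (hconv : Convex ℝ K) (h0 : K ∈ nhds 0) (hsym : ∀ x ∈ K, -x ∈ K)
    (hbd : Bornology.IsVonNBounded ℝ K)
    (b : OrthonormalBasis (Fin (k + 2)) ℝ (EuclideanSpace ℝ (Fin (k + 2))))
    {a : EuclideanSpace ℝ (Fin (k + 2))} (ha0 : a ≠ 0)
    (ha : ∀ i : Fin k, inner ℝ (b i.succ.succ) a = (0 : ℝ)) :
    NK (k + 2) K a = ((Measure.addHaarScalarFactor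
          (Measure.hausdorffMeasure ((k + 1 : ℕ) : ℝ) : Measure (EuclideanSpace ℝ (Fin (k + 1))))
          volume : ℝ≥0∞) * (∫⁻ t in Set.Icc (-1 : ℝ) 1, ENNReal.ofReal (|t| ^ k)))⁻¹.toReal *
      (∫⁻ w, ENNReal.ofReal (gauge K (planeRotation b a + tailMap b w) ^ (k + 1))⁻¹)⁻¹.toReal := by
  have hd : ((k + 2 : ℕ) : ℝ) - 1 = ((k + 1 : ℕ) : ℝ) := by push_cast; ring
  have hn : ‖a‖ ≠ 0 := by simpa using ha0
  rw [NK, if_neg ha0, sectVol, hd,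
    hausdorffMeasure_inter_orthogonal_eq_lintegral_gauge b hcl hconv h0 hsym hbd ha0 ha,
    ENNReal.toReal_mul, ENNReal.toReal_ofReal (norm_nonneg a), ENNReal.toReal_mul,
    ENNReal.toReal_inv, ENNReal.toReal_inv, div_mul_cancel_left₀ hn, mul_inv]

/-- **Busemann's theorem**: the function `N_K` is subadditive. -/
theorem NK_add_le (hcpt : IsCompact K) (hconv : Convex ℝ K) (hint : (interior K).Nonempty)
    (hsym : K = -K) (x y : EuclideanSpace ℝ (Fin n)) :
    NK n K (x + y) ≤ NK n K x + NK n K y := by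
  have hzero := zero_mem_interior_of_convex_of_eq_neg hconv hint hsym
  by_cases hx : x = 0
  · simp [hx, NK_zero]
  by_cases hy : y = 0
  · simp [hy, NK_zero]
  by_cases hxy : x + y = 0
  · simpa [hxy, NK_zero] using add_nonneg (NK_nonneg x) (NK_nonneg y)
  match n, K with
  | 0, _ => exact absurd (Subsingleton.elim x 0) hx
  | 1, K =>
    have h : ∀ z : EuclideanSpace ℝ (Fin 1), z ≠ 0 → NK 1 K z = ‖z‖ := by
      intro z hz
      have hz0 : z 0 ≠ 0 := fun h => hz (by ext i; simpa [Subsingleton.elim i 0] using h)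
      have hsing : K ∩ {x : EuclideanSpace ℝ (Fin 1) | inner ℝ x z = (0 : ℝ)} = {0} := by
        ext w
        simp only [Set.mem_inter_iff, Set.mem_ofPred_eq, Set.mem_singleton_iff]
        constructor
        · rintro ⟨-, hw⟩
          ext i
          simpa [PiLp.inner_apply, hz0, Subsingleton.elim i 0] using hw
        · rintro rfl
          exact ⟨interior_subset hzero, inner_zero_left _⟩
      simp [NK, hz, sectVol, hsing]
    rw [h _ hx, h _ hy, h _ hxy]
    exact norm_add_le x y
  | k + 2, K =>
    have h0 : K ∈ nhds 0 := mem_interior_iff_mem_nhds.1 hzero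
    have hneg : ∀ z ∈ K, -z ∈ K := fun z hz => by rw [hsym]; simpa using hz
    have hbd : Bornology.IsVonNBounded ℝ K :=
      NormedSpace.isVonNBounded_of_isBounded ℝ hcpt.isBounded
    obtain ⟨b, hb⟩ := exists_orthonormalBasis_tail_orthogonal (k := k)
      (E := EuclideanSpace ℝ (Fin (k + 2))) (by simp) x y
    have hbx := fun i => (hb i).1
    have hby := fun i => (hb i).2
    have hbxy : ∀ i : Fin k, inner ℝ (b i.succ.succ) (x + y) = (0 : ℝ) := fun i => by
      rw [inner_add_right, hbx, hby, add_zero]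
    have hux := planeRotation_add_tailMap_ne_zero b hx hbx
    have huy := planeRotation_add_tailMap_ne_zero b hy hby
    have huxy := planeRotation_add_tailMap_ne_zero b hxy hbxy
    rw [NK_eq_toReal_inv_lintegral hcpt.isClosed hconv h0 hneg hbd b hx hbx,
      NK_eq_toReal_inv_lintegral hcpt.isClosed hconv h0 hneg hbd b hy hby,
      NK_eq_toReal_inv_lintegral hcpt.isClosed hconv h0 hneg hbd b hxy hbxy, ← mul_add]
    refine mul_le_mul_of_nonneg_left ?_ ENNReal.toReal_nonneg
    have hfx := ENNReal.inv_ne_top.2 (lintegral_gauge_ne_zero (tailMap b) hconv h0 hbd hux)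
    have hfy := ENNReal.inv_ne_top.2 (lintegral_gauge_ne_zero (tailMap b) hconv h0 hbd huy)
    rw [← ENNReal.toReal_add hfx hfy]
    refine ENNReal.toReal_mono (ENNReal.add_ne_top.2 ⟨hfx, hfy⟩) ?_
    rw [planeRotation_add] at huxy ⊢
    exact inv_lintegral_gauge_add_le (tailMap b) hconv h0 hbd hux huy huxy

theorem convexOn_NK (hcpt : IsCompact K) (hconv : Convex ℝ K) (hint : (interior K).Nonempty)
    (hsym : K = -K) : ConvexOn ℝ Set.univ (NK n K) := by
  refine ⟨convex_univ, fun x _ y _ s t hs ht _ => ?_⟩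
  have := NK_add_le hcpt hconv hint hsym (s • x) (t • y)
  rwa [NK_smul_of_nonneg hs, NK_smul_of_nonneg ht] at this

end Body

theorem mem_convexHull_cube_vertices {n : ℕ} {x : EuclideanSpace ℝ (Fin n)}
    (hx : ∀ j, x j ∈ Set.Icc (-1 : ℝ) 1) :
    x ∈ convexHull ℝ {s : EuclideanSpace ℝ (Fin n) | ∀ j, s j = 1 ∨ s j = -1} := by
  have h : (WithLp.ofLp x : Fin n → ℝ) ∈
      convexHull ℝ (Set.univ.pi fun _ : Fin n => ({-1, 1} : Set ℝ)) := by
    rw [convexHull_pi]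
    intro j _
    rw [convexHull_pair, segment_eq_Icc (by norm_num)]
    exact hx j
  have h' := Set.mem_image_of_mem (WithLp.linearEquiv 2 ℝ (Fin n → ℝ)).symm.toLinearMap h
  rw [LinearMap.image_convexHull] at h'
  refine convexHull_mono ?_ h'
  rintro _ ⟨v, hv, rfl⟩ j
  simpa [or_comm] using hv j (Set.mem_univ j)

theorem finite_cube_vertices (n : ℕ) :
    {s : EuclideanSpace ℝ (Fin n) | ∀ j, s j = 1 ∨ s j = -1}.Finite := by
  have h : (Set.univ.pi fun _ : Fin n => ({1, -1} : Set ℝ)).Finite :=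
    Set.Finite.pi fun _ => Set.toFinite _
  refine (h.image (WithLp.toLp 2)).subset fun s hs => ⟨WithLp.ofLp s, fun j _ => ?_, rfl⟩
  simpa using hs j

/-- For an origin-symmetric convex body `K`, the maximum of `N_K` over the cube
`[-1,1]^n` is attained at a vertex, i.e. at a point with coordinates `±1`. -/
theorem NK_max_on_cube_at_vertex (n : ℕ)
    (K : Set (EuclideanSpace ℝ (Fin n)))
    (hK_cpt : IsCompact K) (hK_conv : Convex ℝ K)
    (hK_int : (interior K).Nonempty) (hK_sym : K = -K) :
    ∃ s : EuclideanSpace ℝ (Fin n), (∀ j, s j = 1 ∨ s j = -1) ∧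
      IsGreatest
        (NK n K '' {x : EuclideanSpace ℝ (Fin n) | ∀ j, x j ∈ Set.Icc (-1:ℝ) 1})
        (NK n K s) := by
  obtain ⟨s, hs, hmax⟩ := Set.exists_max_image _ (NK n K) (finite_cube_vertices n)
    ⟨WithLp.toLp 2 fun _ => 1, fun _ => Or.inl rfl⟩
  refine ⟨s, hs, ⟨s, fun j => ?_, rfl⟩, ?_⟩
  · rcases hs j with h | h <;> norm_num [h]
  · rintro _ ⟨x, hx, rfl⟩
    obtain ⟨v, hv, hle⟩ := (convexOn_NK hK_cpt hK_conv hK_int hK_sym).exists_ge_of_mem_convexHull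
      (Set.subset_univ _) (mem_convexHull_cube_vertices hx)
    exact hle.trans (hmax v hv)
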